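/- arXiv:0910.4901 — 4 statements merged into one kernel-verified Lean document; each statement's English description precedes it below -/
import Mathlib

section
/- Let M_t, M_r be positive integers, M_* = min(M_t, M_r) and M^* = max(M_t, M_r). For every real b ≥ 0, the minimum over k ∈ {0, 1, …, M_*} of b·k + (M_t − k)(M_r − k) equals Σ_{i=1}^{M_*} min{b, 2i − 1 + M^* − M_*}. -/
open Finset

/-- Corner values of the DMT curve: `d*(k) = (Mt - k)(Mr - k)`. -/
noncomputable def cornerVal (Mt Mr k : ℕ) : ℝ := ((Mt : ℝ) - k) * ((Mr : ℝ) - k)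

/-- The piecewise-linear DMT curve `d* : [0,∞) → ℝ` interpolating the points
`(k, (Mt-k)(Mr-k))` for `k = 0,…,min Mt Mr`, and equal to `0` for `r ≥ min Mt Mr`. -/
noncomputable def dstar (Mt Mr : ℕ) (r : ℝ) : ℝ :=
  if (min Mt Mr : ℝ) ≤ r then 0
  else (1 - (r - ⌊r⌋₊)) * cornerVal Mt Mr ⌊r⌋₊ + (r - ⌊r⌋₊) * cornerVal Mt Mr (⌊r⌋₊ + 1)

/-- The optimal distortion exponent `Δ(b) = ∑_{i=1}^{M_*} min {b, 2i-1+M^*-M_*}`. -/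
noncomputable def Delta (Mt Mr : ℕ) (b : ℝ) : ℝ :=
  ∑ i ∈ Finset.Icc 1 (min Mt Mr),
    min b (2 * (i : ℝ) - 1 + (max Mt Mr : ℝ) - (min Mt Mr : ℝ))

theorem sum_min_le (c : ℕ → ℝ) (b : ℝ) (k j : ℕ) :
    ∑ i ∈ range (j + k), min b (c i) ≤ b * k + ∑ i ∈ range j, c i := by
  induction k with
  | zero => simpa using sum_le_sum fun i _ => min_le_right b (c i)
  | succ k ih =>
    rw [← add_assoc, sum_range_succ]
    push_cast
    linarith [min_le_left b (c (j + k))]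

theorem exists_sum_min_eq {c : ℕ → ℝ} (hc : Monotone c) (b : ℝ) (n : ℕ) :
    ∃ k j, j + k = n ∧ ∑ i ∈ range n, min b (c i) = b * k + ∑ i ∈ range j, c i := by
  induction n with
  | zero => exact ⟨0, 0, by simp⟩
  | succ n ih =>
    rcases le_total (c n) b with h | h
    · refine ⟨0, n + 1, rfl, ?_⟩
      simpa using sum_congr rfl fun i hi =>
        min_eq_right ((hc (Nat.lt_succ_iff.mp (mem_range.mp hi))).trans h)
    · obtain ⟨k, j, hkj, hsum⟩ := ih
      refine ⟨k + 1, j, by omega, ?_⟩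
      rw [sum_range_succ, hsum, min_eq_left h]
      push_cast
      ring

theorem sum_range_odd_add (D : ℝ) (j : ℕ) :
    ∑ i ∈ range j, (2 * (i : ℝ) + 1 + D) = j * (j + D) := by
  induction j with
  | zero => simp
  | succ j ih =>
    rw [sum_range_succ, ih]
    push_cast
    ring

theorem cornerVal_eq_sum {Mt Mr k j : ℕ} (h : j + k = min Mt Mr) :
    cornerVal Mt Mr k =
      ∑ i ∈ range j, (2 * (i : ℝ) + 1 + ((max Mt Mr : ℝ) - (min Mt Mr : ℝ))) := by
  have h' : (j : ℝ) + k = min (Mt : ℝ) Mr := by exact_mod_cast h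
  rw [sum_range_odd_add, eq_sub_of_add_eq h', cornerVal]
  rcases le_total (Mt : ℝ) Mr with hle | hle
  · rw [min_eq_left hle, max_eq_right hle]
    ring
  · rw [min_eq_right hle, max_eq_left hle]
    ring

theorem Delta_eq_sum_range (Mt Mr : ℕ) (b : ℝ) :
    Delta Mt Mr b = ∑ i ∈ range (min Mt Mr),
      min b (2 * (i : ℝ) + 1 + ((max Mt Mr : ℝ) - (min Mt Mr : ℝ))) := by
  rw [Delta, ← Ico_add_one_right_eq_Icc, sum_Ico_eq_sum_range, Nat.add_sub_cancel]
  refine sum_congr rfl fun i _ => ?_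
  push_cast
  congr 1
  ring

/-- The minimum over `k ∈ {0,…,M_*}` of `b·k + (Mt-k)(Mr-k)` equals
`∑_{i=1}^{M_*} min {b, 2i-1+M^*-M_*}`. -/
theorem stmt0 (Mt Mr : ℕ) (hMt : 0 < Mt) (hMr : 0 < Mr) (b : ℝ) (hb : 0 ≤ b) :
    (Finset.Icc 0 (min Mt Mr)).inf' (Finset.nonempty_Icc.mpr (Nat.zero_le _))
      (fun k => b * k + cornerVal Mt Mr k) = Delta Mt Mr b := by
  have hc : Monotone fun i : ℕ =>
      2 * (i : ℝ) + 1 + ((max Mt Mr : ℝ) - (min Mt Mr : ℝ)) := by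
    intro i j hij
    dsimp only
    gcongr
  rw [Delta_eq_sum_range]
  apply le_antisymm
  · obtain ⟨k, j, hkj, hsum⟩ := exists_sum_min_eq hc b (min Mt Mr)
    rw [hsum, ← cornerVal_eq_sum hkj]
    exact inf'_le _ (mem_Icc.mpr ⟨Nat.zero_le _, by omega⟩)
  · refine le_inf' _ _ fun k hk => ?_
    have hkj := Nat.sub_add_cancel (mem_Icc.mp hk).2
    have hle := sum_min_le
      (fun i : ℕ => 2 * (i : ℝ) + 1 + ((max Mt Mr : ℝ) - (min Mt Mr : ℝ))) b k
      (min Mt Mr - k)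
    rwa [hkj, ← cornerVal_eq_sum hkj] at hle
end

section
/- Let M_t, M_r be positive integers, M_* = min(M_t, M_r), M^* = max(M_t, M_r), and let d* : [0, ∞) → ℝ be the piecewise-linear function that interpolates the points (k, (M_t − k)(M_r − k)) for k = 0, 1, …, M_* and equals 0 for r ≥ M_*. Then for every real b ≥ 0, the infimum over r ∈ [0, M_*] of b·r + d*(r) equals Σ_{i=1}^{M_*} min{b, 2i − 1 + M^* − M_*}; that is, the highest possible y-intercept of a line of slope −b lying on or below the DMT curve on [0, M_*] is Σ_{i=1}^{M_*} min{b, 2i − 1 + M^* − M_*}. -/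
open Finset

/-- The truncated sum is a lower bound for every corner intercept. -/
theorem sum_min_le_corner (b c : ℝ) (n j : ℕ) (hj : j ≤ n) :
    ∑ i ∈ Finset.Icc 1 n, min b (2 * (i : ℝ) - 1 + c) ≤
      b * ((n : ℝ) - j) + (j : ℝ) * (j + c) := by
  induction n generalizing j with
  | zero =>
    obtain rfl : j = 0 := by omega
    simp
  | succ n ih =>
    rw [Finset.sum_Icc_succ_top (by omega)]
    rcases hj.eq_or_lt with rfl | hlt
    · have h := ih n le_rfl
      have h' := min_le_right b (2 * ((n + 1 : ℕ) : ℝ) - 1 + c)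
      push_cast at *
      linarith
    · have h := ih j (by omega)
      have h' := min_le_left b (2 * ((n + 1 : ℕ) : ℝ) - 1 + c)
      push_cast at *
      linarith

theorem sum_odd_add_const (c : ℝ) (n : ℕ) :
    ∑ i ∈ Finset.Icc 1 n, (2 * (i : ℝ) - 1 + c) = (n : ℝ) * (n + c) := by
  induction n with
  | zero => simp
  | succ n ih =>
    rw [Finset.sum_Icc_succ_top (by omega), ih]
    push_cast
    ring

/-- Some corner intercept attains the truncated sum. -/
theorem exists_corner_eq_sum_min (b c : ℝ) (n : ℕ) :
    ∃ j ≤ n, b * ((n : ℝ) - j) + (j : ℝ) * (j + c) =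
      ∑ i ∈ Finset.Icc 1 n, min b (2 * (i : ℝ) - 1 + c) := by
  induction n with
  | zero => exact ⟨0, le_rfl, by simp⟩
  | succ n ih =>
    rcases le_total (2 * ((n + 1 : ℕ) : ℝ) - 1 + c) b with h | h
    · refine ⟨n + 1, le_rfl, ?_⟩
      rw [sub_self, mul_zero, zero_add, ← sum_odd_add_const]
      refine Finset.sum_congr rfl fun i hi => (min_eq_right ?_).symm
      have hi' : (i : ℝ) ≤ ((n + 1 : ℕ) : ℝ) := by exact_mod_cast (Finset.mem_Icc.mp hi).2
      linarith
    · obtain ⟨j, hj, hEq⟩ := ih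
      refine ⟨j, by omega, ?_⟩
      rw [Finset.sum_Icc_succ_top (by omega), min_eq_left h, ← hEq]
      push_cast
      ring

theorem cornerVal_eq_min_max (Mt Mr k : ℕ) :
    cornerVal Mt Mr k = (((min Mt Mr : ℕ) : ℝ) - k) * (((max Mt Mr : ℕ) : ℝ) - k) := by
  unfold cornerVal
  rcases le_total Mt Mr with h | h
  · rw [min_eq_left h, max_eq_right h]
  · rw [min_eq_right h, max_eq_left h, mul_comm]

theorem dstar_natCast (Mt Mr k : ℕ) (hk : k ≤ min Mt Mr) :
    dstar Mt Mr k = cornerVal Mt Mr k := by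
  unfold dstar
  split_ifs with h
  · have h' : min Mt Mr ≤ k := by exact_mod_cast h
    rw [cornerVal_eq_min_max, le_antisymm hk h', sub_self, zero_mul]
  · simp

theorem Delta_le_corner (Mt Mr : ℕ) (b : ℝ) (k : ℕ) (hk : k ≤ min Mt Mr) :
    Delta Mt Mr b ≤ b * k + cornerVal Mt Mr k := by
  have h := sum_min_le_corner b ((max Mt Mr : ℝ) - (min Mt Mr : ℝ)) (min Mt Mr)
    (min Mt Mr - k) (Nat.sub_le _ _)
  rw [cornerVal_eq_min_max]
  simp only [Delta, add_sub_assoc]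
  rw [Nat.cast_sub hk] at h
  refine h.trans_eq ?_
  push_cast
  ring

theorem exists_corner_eq_Delta (Mt Mr : ℕ) (b : ℝ) :
    ∃ k ≤ min Mt Mr, b * k + cornerVal Mt Mr k = Delta Mt Mr b := by
  obtain ⟨j, hj, h⟩ :=
    exists_corner_eq_sum_min b ((max Mt Mr : ℝ) - (min Mt Mr : ℝ)) (min Mt Mr)
  refine ⟨min Mt Mr - j, Nat.sub_le _ _, ?_⟩
  rw [cornerVal_eq_min_max, Nat.cast_sub hj]
  simp only [Delta, add_sub_assoc]
  rw [← h]
  push_cast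
  ring

theorem Delta_le_dstar (Mt Mr : ℕ) (b r : ℝ) (h0 : 0 ≤ r) (hr : r ≤ (min Mt Mr : ℕ)) :
    Delta Mt Mr b ≤ b * r + dstar Mt Mr r := by
  rcases hr.eq_or_lt with rfl | hlt
  · rw [dstar_natCast Mt Mr _ le_rfl]
    exact Delta_le_corner Mt Mr b _ le_rfl
  · have hfloor : ⌊r⌋₊ < min Mt Mr := (Nat.floor_lt h0).mpr hlt
    have h1 := Delta_le_corner Mt Mr b ⌊r⌋₊ hfloor.le
    have h2 := Delta_le_corner Mt Mr b (⌊r⌋₊ + 1) hfloor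
    have ht0 : 0 ≤ r - ⌊r⌋₊ := sub_nonneg.mpr (Nat.floor_le h0)
    have ht1 : 0 ≤ 1 - (r - ⌊r⌋₊) := by linarith [Nat.lt_floor_add_one r]
    rw [dstar, if_neg (by rw [← Nat.cast_min]; exact not_le.mpr hlt)]
    have e1 := mul_le_mul_of_nonneg_left h1 ht1
    have e2 := mul_le_mul_of_nonneg_left h2 ht0
    push_cast at e2
    linarith

/-- The infimum over `r ∈ [0, M_*]` of `b·r + d*(r)` (the highest `y`-intercept of a
line of slope `-b` lying under the DMT curve) equals `∑_{i=1}^{M_*} min {b, 2i-1+M^*-M_*}`. -/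
theorem stmt1 (Mt Mr : ℕ) (hMt : 0 < Mt) (hMr : 0 < Mr) (b : ℝ) (hb : 0 ≤ b) :
    sInf ((fun r => b * r + dstar Mt Mr r) '' Set.Icc (0 : ℝ) (min Mt Mr : ℕ)) =
      Delta Mt Mr b := by
  refine IsLeast.csInf_eq ⟨?_, ?_⟩
  · obtain ⟨k, hk, h⟩ := exists_corner_eq_Delta Mt Mr b
    refine ⟨k, ⟨Nat.cast_nonneg k, Nat.cast_le.mpr hk⟩, ?_⟩
    simp only [dstar_natCast Mt Mr k hk, h]
  · rintro _ ⟨r, ⟨h0, hr⟩, rfl⟩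
    exact Delta_le_dstar Mt Mr b r h0 hr
end

section
/- Let M_t, M_r be positive integers, M_* = min(M_t, M_r), M^* = max(M_t, M_r), and let d* : [0, ∞) → ℝ be the piecewise-linear function that interpolates the points (k, (M_t − k)(M_r − k)) for k = 0, 1, …, M_* and equals 0 for r ≥ M_*. Fix b ≥ 0. Then for every positive integer n and all nonnegative reals r_1, …, r_n, with partial sums r̄_0 = 0 and r̄_k = r_1 + ⋯ + r_k, one has min{ min_{0 ≤ k ≤ n−1} (d*(r̄_{k+1}) + b·r̄_k), b·r̄_n } ≤ Σ_{i=1}^{M_*} min{b, 2i − 1 + M^* − M_*}. -/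
open Finset

/-- The corner values are antitone in the corner index up to `min Mt Mr`. -/
lemma cornerVal_le_cornerVal {Mt Mr k l : ℕ} (hkl : k ≤ l) (hl : l ≤ min Mt Mr) :
    cornerVal Mt Mr l ≤ cornerVal Mt Mr k := by
  have hkl' : (k : ℝ) ≤ l := by exact_mod_cast hkl
  have hlt : (l : ℝ) ≤ Mt := by exact_mod_cast hl.trans (min_le_left _ _)
  have hlr : (l : ℝ) ≤ Mr := by exact_mod_cast hl.trans (min_le_right _ _)
  unfold cornerVal
  exact mul_le_mul (by linarith) (by linarith) (by linarith) (by linarith)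

lemma cornerVal_nonneg {Mt Mr k : ℕ} (hk : k ≤ min Mt Mr) : 0 ≤ cornerVal Mt Mr k := by
  have hkt : (k : ℝ) ≤ Mt := by exact_mod_cast hk.trans (min_le_left _ _)
  have hkr : (k : ℝ) ≤ Mr := by exact_mod_cast hk.trans (min_le_right _ _)
  exact mul_nonneg (by linarith) (by linarith)

/-- To the right of a corner, the DMT curve lies below the value at that corner. -/
lemma dstar_le_cornerVal {Mt Mr k : ℕ} (hk : k ≤ min Mt Mr) {x : ℝ} (hx : (k : ℝ) ≤ x) :
    dstar Mt Mr x ≤ cornerVal Mt Mr k := by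
  unfold dstar
  split_ifs with h
  · exact cornerVal_nonneg hk
  · have hx0 : 0 ≤ x := (Nat.cast_nonneg k).trans hx
    have hfloor : ⌊x⌋₊ < min Mt Mr := by
      rw [Nat.floor_lt hx0]
      push_cast
      exact not_le.mp h
    have hkf : k ≤ ⌊x⌋₊ := Nat.le_floor hx
    have h0 := cornerVal_le_cornerVal (Mt := Mt) (Mr := Mr) hkf hfloor.le
    have h1 := cornerVal_le_cornerVal (Mt := Mt) (Mr := Mr) (hkf.trans (Nat.le_succ _)) hfloor
    have hlo := Nat.floor_le hx0
    have hhi := Nat.lt_floor_add_one x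
    calc _ ≤ (1 - (x - ⌊x⌋₊)) * cornerVal Mt Mr k + (x - ⌊x⌋₊) * cornerVal Mt Mr k :=
          add_le_add (mul_le_mul_of_nonneg_left h0 (by linarith))
            (mul_le_mul_of_nonneg_left h1 (by linarith))
      _ = cornerVal Mt Mr k := by ring

lemma sum_Icc_two_mul_sub_one_add (D : ℝ) (m : ℕ) :
    ∑ i ∈ Finset.Icc 1 m, (2 * (i : ℝ) - 1 + D) = (m : ℝ) * (m + D) := by
  induction m with
  | zero => simp
  | succ m ih =>
    rw [Finset.sum_Icc_succ_top (by omega), ih]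
    push_cast
    ring

/-- A sum of minima of a constant and an increasing arithmetic progression is attained by
truncating the progression at some index. -/
lemma exists_truncation_eq_sum_min (b D : ℝ) (m : ℕ) :
    ∃ j ≤ m, (j : ℝ) * (j + D) + b * ((m : ℝ) - j) =
      ∑ i ∈ Finset.Icc 1 m, min b (2 * (i : ℝ) - 1 + D) := by
  induction m with
  | zero => exact ⟨0, le_rfl, by simp⟩
  | succ m ih =>
    rcases le_total (2 * ((m + 1 : ℕ) : ℝ) - 1 + D) b with h | h
    · refine ⟨m + 1, le_rfl, ?_⟩
      rw [sub_self, mul_zero, add_zero, ← sum_Icc_two_mul_sub_one_add]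
      refine Finset.sum_congr rfl fun i hi => (min_eq_right ?_).symm
      have : (i : ℝ) ≤ (m + 1 : ℕ) := by exact_mod_cast (Finset.mem_Icc.mp hi).2
      linarith
    · obtain ⟨j, hj, hsum⟩ := ih
      refine ⟨j, hj.trans (Nat.le_succ m), ?_⟩
      rw [Finset.sum_Icc_succ_top (by omega), ← hsum, min_eq_left h]
      push_cast
      ring

/-- The optimal distortion exponent is the value of `d*(k) + b * k` at some corner `k`. -/
lemma exists_cornerVal_add_eq_Delta (Mt Mr : ℕ) (b : ℝ) :
    ∃ k ≤ min Mt Mr, cornerVal Mt Mr k + b * k = Delta Mt Mr b := by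
  obtain ⟨j, hj, hsum⟩ :=
    exists_truncation_eq_sum_min b ((max Mt Mr : ℝ) - (min Mt Mr : ℝ)) (min Mt Mr)
  refine ⟨min Mt Mr - j, Nat.sub_le _ _, ?_⟩
  unfold Delta
  simp only [add_sub_assoc]
  rw [hsum.symm, cornerVal, Nat.cast_sub hj]
  push_cast
  rcases le_total (Mt : ℝ) Mr with h | h
  · rw [min_eq_left h, max_eq_right h]
    ring
  · rw [min_eq_right h, max_eq_left h]
    ring

/-- A sequence starting at or below `c` either is at most `c` at `n` or crosses `c` before. -/
lemma le_or_exists_crossing {s : ℕ → ℝ} {c : ℝ} (h0 : s 0 ≤ c) (n : ℕ) :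
    s n ≤ c ∨ ∃ j < n, s j ≤ c ∧ c ≤ s (j + 1) := by
  induction n with
  | zero => exact Or.inl h0
  | succ n ih =>
    rcases ih with h | ⟨j, hj, h⟩
    · rcases le_total (s (n + 1)) c with h' | h'
      · exact Or.inl h'
      · exact Or.inr ⟨n, Nat.lt_succ_self n, h, h'⟩
    · exact Or.inr ⟨j, hj.trans (Nat.lt_succ_self n), h⟩

/-- Converse: for every number of layers `n ≥ 1` and nonnegative multiplexing gains
`r_1,…,r_n` (here `r 0,…,r (n-1)` with partial sums `r̄_k = ∑_{j<k} r j`), the achieved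
exponent `min { min_{0 ≤ k ≤ n-1} (d*(r̄_{k+1}) + b·r̄_k), b·r̄_n }` is at most
`∑_{i=1}^{M_*} min {b, 2i-1+M^*-M_*}`. -/
theorem stmt6 (Mt Mr : ℕ) (hMt : 0 < Mt) (hMr : 0 < Mr) (b : ℝ) (hb : 0 ≤ b)
    (n : ℕ) (hn : 0 < n) (r : ℕ → ℝ) (hr : ∀ k, 0 ≤ r k) :
    min
      ((Finset.range n).inf' (Finset.nonempty_range_iff.mpr hn.ne')
        (fun k => dstar Mt Mr (∑ j ∈ Finset.range (k + 1), r j) +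
          b * ∑ j ∈ Finset.range k, r j))
      (b * ∑ j ∈ Finset.range n, r j) ≤ Delta Mt Mr b := by
  obtain ⟨k, hk, hDelta⟩ := exists_cornerVal_add_eq_Delta Mt Mr b
  rw [← hDelta]
  rcases le_or_exists_crossing (s := fun m => ∑ j ∈ Finset.range m, r j) (c := (k : ℝ))
    (by simp) n with h | ⟨j, hj, hle, hge⟩
  · refine (min_le_right _ _).trans ?_
    have := mul_le_mul_of_nonneg_left h hb
    have := cornerVal_nonneg hk
    linarith
  · refine (min_le_left _ _).trans ((Finset.inf'_le _ (Finset.mem_range.mpr hj)).trans ?_)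
    exact add_le_add (dstar_le_cornerVal hk hge) (mul_le_mul_of_nonneg_left hle hb)
end

section
/- Let M_t, M_r be positive integers, M_* = min(M_t, M_r), M^* = max(M_t, M_r), and define Δ(b) = Σ_{i=1}^{M_*} min{b, 2i − 1 + M^* − M_*} for b ≥ 0. Then for every integer k with 0 ≤ k ≤ M_* − 1, evaluating at the breakpoint b = (M_t + M_r) − (2k + 1) gives Δ((M_t + M_r) − (2k + 1)) = ((M_t + M_r) − (2k + 1))·(k + 1) + (M_t − k − 1)(M_r − k − 1). -/
open Finset

theorem sum_Icc_odd_add (n : ℕ) (c : ℝ) :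
    ∑ i ∈ Finset.Icc 1 n, (2 * (i : ℝ) - 1 + c) = n * (n + c) := by
  induction n with
  | zero => simp
  | succ n ih =>
    rw [Finset.sum_Icc_succ_top (by omega), ih]
    push_cast
    ring

theorem sum_Icc_min_odd_add (n j : ℕ) (c : ℝ) :
    ∑ i ∈ Finset.Icc 1 (n + j), min (2 * (n : ℝ) + 1 + c) (2 * (i : ℝ) - 1 + c) =
      (2 * (n : ℝ) + 1 + c) * j + n * (n + c) := by
  induction j with
  | zero =>
    rw [add_zero, ← sum_Icc_odd_add, Nat.cast_zero, mul_zero, zero_add]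
    refine Finset.sum_congr rfl fun i hi => min_eq_right ?_
    have hin : (i : ℝ) ≤ n := by exact_mod_cast (Finset.mem_Icc.mp hi).2
    linarith
  | succ j ih =>
    have hj : (0 : ℝ) ≤ j := j.cast_nonneg
    rw [← add_assoc, Finset.sum_Icc_succ_top (by omega), ih, min_eq_left]
    · push_cast
      ring
    · push_cast
      linarith

theorem Delta_breakpoint (Mt Mr k n : ℕ) (h : min Mt Mr = n + (k + 1)) :
    Delta Mt Mr ((Mt : ℝ) + Mr - (2 * k + 1)) =
      ((Mt : ℝ) + Mr - (2 * k + 1)) * (k + 1) +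
        ((Mt : ℝ) - k - 1) * ((Mr : ℝ) - k - 1) := by
  have hmin : min (Mt : ℝ) Mr = n + (k + 1) := by exact_mod_cast congrArg (Nat.cast (R := ℝ)) h
  have hadd := min_add_max (Mt : ℝ) Mr
  have hmul := min_mul_max (Mt : ℝ) Mr
  have key := sum_Icc_min_odd_add n (k + 1) (max (Mt : ℝ) Mr - min (Mt : ℝ) Mr)
  have hb : (Mt : ℝ) + Mr - (2 * k + 1) =
      2 * (n : ℝ) + 1 + (max (Mt : ℝ) Mr - min (Mt : ℝ) Mr) := by linarith
  simp only [Delta, h, hb, add_sub_assoc] at key ⊢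
  rw [key, hmin]
  rw [hmin] at hadd hmul
  push_cast
  linear_combination hmul - (k + 1) * hadd

/-- At the breakpoint `b = (Mt+Mr) - (2k+1)`, `0 ≤ k ≤ M_* - 1`, the distortion exponent
is `Δ(b) = b·(k+1) + d*(k+1)` with `d*(k+1) = (Mt-k-1)(Mr-k-1)`. -/
theorem stmt8 (Mt Mr : ℕ) (hMt : 0 < Mt) (hMr : 0 < Mr) (k : ℕ)
    (hk : k + 1 ≤ min Mt Mr) :
    Delta Mt Mr ((Mt : ℝ) + Mr - (2 * k + 1)) =
      ((Mt : ℝ) + Mr - (2 * k + 1)) * (k + 1) +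
        ((Mt : ℝ) - k - 1) * ((Mr : ℝ) - k - 1) := by
  obtain ⟨n, hn⟩ := Nat.exists_eq_add_of_le' hk
  exact Delta_breakpoint Mt Mr k n hn
end
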